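/- Let p be a positive integer and let α, β, γ be real numbers with α > 0, β > 0 and γ ≥ 0. Then ∫_{Δ_p} ∏_{j=1}^p t_j^{α−1}(1−t_j)^{β−1} ∏_{1≤j<k≤p}(t_j−t_k)^{2γ} dt_1…dt_p = (1/p!) ∏_{j=0}^{p−1} [Γ(1+γ+jγ)·Γ(α+jγ)·Γ(β+jγ)] / [Γ(1+γ)·Γ(α+β+(p+j−1)γ)], where Γ denotes the Euler Gamma function. -/

import Mathlib

open MeasureTheory

namespace Selb
open Finset Polynomial

/-- absolute Vandermonde product -/
noncomputable def V {n : ℕ} (x : Fin n → ℝ) : ℝ :=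
  ∏ i, ∏ j, if i < j then |x i - x j| else 1

/-- product of differences to the other nodes -/
noncomputable def D {n : ℕ} (a : Fin (n+1) → ℝ) (j : Fin (n+1)) : ℝ :=
  ∏ i : Fin n, (a j - a (j.succAbove i))

theorem V_eq_Ioi {n : ℕ} (x : Fin n → ℝ) : V x = ∏ i, ∏ j ∈ Ioi i, |x i - x j| := by
  unfold V
  refine Finset.prod_congr rfl fun i _ => ?_
  rw [← Finset.prod_filter]
  congr 1
  ext j; simp

theorem V_eq_det {n : ℕ} (x : Fin n → ℝ) : |(Matrix.vandermonde x).det| = V x := by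
  rw [V_eq_Ioi, Matrix.det_vandermonde, Finset.abs_prod]
  refine Finset.prod_congr rfl fun i _ => ?_
  rw [Finset.abs_prod]
  refine Finset.prod_congr rfl fun j _ => abs_sub_comm _ _

theorem V_nonneg {n : ℕ} (x : Fin n → ℝ) : 0 ≤ V x := by
  rw [← V_eq_det]; positivity

theorem V_pos {n : ℕ} {x : Fin n → ℝ} (hx : Function.Injective x) : 0 < V x := by
  rw [← V_eq_det]
  exact abs_pos.2 (Matrix.det_vandermonde_ne_zero_iff.2 hx)

theorem V_cons {n : ℕ} (z : ℝ) (x : Fin n → ℝ) :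
    V (Fin.cons z x : Fin (n+1) → ℝ) = (∏ i, |z - x i|) * V x := by
  unfold V
  rw [Fin.prod_univ_succ]
  congr 1
  · rw [Fin.prod_univ_succ]; simp
  · refine Finset.prod_congr rfl fun i _ => ?_
    rw [Fin.prod_univ_succ]; simp

theorem V_snoc {n : ℕ} (z : ℝ) (x : Fin n → ℝ) :
    V (Fin.snoc x z : Fin (n+1) → ℝ) = (∏ i, |x i - z|) * V x := by
  unfold V
  rw [Fin.prod_univ_castSucc, ← Finset.prod_mul_distrib]
  have : ∏ j, (if Fin.last n < j then |(Fin.snoc x z : Fin (n+1) → ℝ) (Fin.last n) -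
      (Fin.snoc x z : Fin (n+1) → ℝ) j| else 1) = 1 := by
    refine Finset.prod_eq_one fun j _ => ?_
    rw [if_neg (not_lt.2 (Fin.le_last j))]
  rw [this, mul_one]
  refine Finset.prod_congr rfl fun i _ => ?_
  rw [Fin.prod_univ_castSucc, mul_comm]; simp

theorem D_eq {n : ℕ} (a : Fin (n+1) → ℝ) (j : Fin (n+1)) :
    D a j = ∏ k ∈ Finset.univ.erase j, (a j - a k) := by
  unfold D
  rw [← Finset.compl_singleton, ← Fin.image_succAbove_univ, Finset.prod_image]
  intro x _ y _ h
  exact Fin.succAbove_right_injective h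

theorem prod_off {n : ℕ} (x : Fin n → ℝ) :
    ∏ j, ∏ k ∈ Finset.univ.erase j, |x j - x k| = V x ^ 2 := by
  have h := Finset.prod_prod_Ioi_mul_eq_prod_prod_off_diag (fun i j : Fin n => |x j - x i|)
  simp only [Finset.compl_singleton] at h
  rw [← h, V_eq_Ioi, ← Finset.prod_pow]
  refine Finset.prod_congr rfl fun i _ => ?_
  rw [← Finset.prod_pow]
  refine Finset.prod_congr rfl fun j _ => ?_
  rw [abs_sub_comm (x j), sq]

theorem prod_D {n : ℕ} (a : Fin (n+1) → ℝ) : ∏ j, |D a j| = V a ^ 2 := by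
  rw [← prod_off]
  refine Finset.prod_congr rfl fun i _ => ?_
  rw [D_eq, Finset.abs_prod]

theorem eval_mat {m : ℕ} (v : Fin m → ℝ)
    (p : Fin m → ℝ[X]) (h_deg : ∀ i, (p i).natDegree < m) :
    Matrix.of (fun i j => ((p j).eval (v i))) =
    (Matrix.vandermonde v) * (Matrix.of (fun (i j : Fin m) => (p j).coeff i)) := by
  ext i j
  simp_rw [Matrix.mul_apply, Matrix.of_apply, Matrix.vandermonde_apply]
  rw [Polynomial.eval_eq_sum_range' (h_deg j), ← Fin.sum_univ_eq_sum_range (fun k => (p j).coeff k * v i ^ k)]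
  exact Finset.sum_congr rfl fun k _ => mul_comm _ _

/-- The two families of polynomials. -/
noncomputable def pp {n : ℕ} (x : Fin n → ℝ) : Fin (n+1) → ℝ[X] :=
  Fin.cons (∏ i, (X - C (x i))) (fun i => ∏ k ∈ Finset.univ.erase i, (X - C (x k)))

theorem pp_deg {n : ℕ} (x : Fin n → ℝ) (i : Fin (n+1)) : (pp x i).natDegree < n + 1 := by
  refine Fin.cases ?_ (fun i => ?_) i
  · simp [pp, Polynomial.natDegree_finsetProd_X_sub_C_eq_card]
  · simp only [pp, Fin.cons_succ]
    rw [Polynomial.natDegree_finsetProd_X_sub_C_eq_card]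
    rw [Finset.card_erase_of_mem (Finset.mem_univ _)]
    simp

theorem det_N {n : ℕ} (x : Fin n → ℝ) (hx : Function.Injective x) (a : Fin (n+1) → ℝ) :
    |(Matrix.of (fun i j => ((pp x j).eval (a i)))).det| = V x * V a := by
  obtain ⟨z, hz⟩ := Infinite.exists_notMem_finset (Finset.univ.image x)
  have hz' : ∀ i, z ≠ x i := fun i h => hz (by simp [h])
  set b : Fin (n+1) → ℝ := Fin.cons z x with hb
  have h1 : |(Matrix.of (fun i j => ((pp x j).eval (b i)))).det| = (∏ i, |z - x i|) * V x ^ 2 := by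
    rw [Matrix.det_succ_column_zero, Finset.sum_eq_single 0]
    · have : (Matrix.of (fun i j => ((pp x j).eval (b i)))).submatrix (Fin.succAbove 0) Fin.succ
        = Matrix.diagonal (fun i => ∏ k ∈ Finset.univ.erase i, (x i - x k)) := by
        ext i j
        simp only [hb, pp, Matrix.submatrix_apply, Matrix.of_apply, Fin.zero_succAbove, Fin.cons_succ,
          Polynomial.eval_prod, eval_sub, eval_X, eval_C]
        rw [Matrix.diagonal_apply]
        split_ifs with h
        · subst h; rfl
        · exact Finset.prod_eq_zero (i := i) (by simp [h]) (by simp)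
      rw [this, Matrix.det_diagonal, abs_mul, abs_mul, Finset.abs_prod, ← prod_off]
      simp only [Finset.abs_prod]
      simp [hb, pp, Polynomial.eval_prod, Finset.abs_prod]
    · intro i _ hi
      obtain ⟨k, rfl⟩ := Fin.exists_succ_eq.2 hi
      have : eval (b k.succ) (pp x 0) = 0 := by
        simp only [hb, pp, Fin.cons_succ, Fin.cons_zero, Polynomial.eval_prod, eval_sub, eval_X, eval_C]
        exact Finset.prod_eq_zero (i := k) (by simp) (by simp)
      simp [this]
    · simp
  have h2 : 0 < ∏ i, |z - x i| := Finset.prod_pos fun i _ => abs_pos.2 (sub_ne_zero.2 (hz' i))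
  have h3 := V_pos hx
  rw [eval_mat _ _ (pp_deg x), Matrix.det_mul, abs_mul, V_eq_det, V_cons] at h1
  rw [eval_mat _ _ (pp_deg x), Matrix.det_mul, abs_mul, V_eq_det, mul_comm]
  congr 1
  have : (∏ i, |z - x i|) * V x ≠ 0 := by positivity
  apply mul_left_cancel₀ this
  rw [h1]; ring

end Selb


namespace Selb
open Finset Polynomial

/-- `x` interlaces `a`. -/
def Inter {n : ℕ} (a : Fin (n+1) → ℝ) (x : Fin n → ℝ) : Prop :=
  ∀ i : Fin n, a i.succ < x i ∧ x i < a i.castSucc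

theorem Inter.lt {n : ℕ} {a : Fin (n+1) → ℝ} (ha : StrictAnti a) {x : Fin n → ℝ} (h : Inter a x)
    {j : Fin (n+1)} {i : Fin n} (hij : i.castSucc < j) : a j < x i :=
  lt_of_le_of_lt (ha.antitone (Fin.castSucc_lt_iff_succ_le.1 hij)) (h i).1

theorem Inter.gt {n : ℕ} {a : Fin (n+1) → ℝ} (ha : StrictAnti a) {x : Fin n → ℝ} (h : Inter a x)
    {j : Fin (n+1)} {i : Fin n} (hij : j ≤ i.castSucc) : x i < a j :=
  lt_of_lt_of_le (h i).2 (ha.antitone hij)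

theorem Inter.strictAnti {n : ℕ} {a : Fin (n+1) → ℝ} (ha : StrictAnti a) {x : Fin n → ℝ}
    (h : Inter a x) : StrictAnti x := by
  intro i j hij
  have h1 := h.lt ha (j := j.castSucc) (i := i) (by simpa using hij)
  exact (h j).2.trans h1

theorem Inter.div_pos {n : ℕ} {a : Fin (n+1) → ℝ} (ha : StrictAnti a) {x : Fin n → ℝ}
    (h : Inter a x) (j : Fin (n+1)) (i : Fin n) :
    0 < (a j - x i) / (a j - a (j.succAbove i)) := by
  rcases lt_or_ge i.castSucc j with hij | hij
  · rw [Fin.succAbove_of_castSucc_lt _ _ hij]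
    exact div_pos_of_neg_of_neg (sub_neg.2 (h.lt ha hij)) (sub_neg.2 (ha hij))
  · rw [Fin.succAbove_of_le_castSucc _ _ hij]
    exact _root_.div_pos (sub_pos.2 (h.gt ha hij))
      (sub_pos.2 (ha (lt_of_le_of_lt hij Fin.castSucc_lt_succ)))

/-- the change of variables -/
noncomputable def f {n : ℕ} (a : Fin (n+1) → ℝ) (v : Fin (n+1) → ℝ) (j : Fin (n+1)) : ℝ :=
  (∏ i : Fin n, (a j - v i.succ)) * v 0 * (D a j)⁻¹

/-- its domain -/
def S {n : ℕ} (a : Fin (n+1) → ℝ) : Set (Fin (n+1) → ℝ) :=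
  {v | 0 < v 0 ∧ Inter a (fun i => v i.succ)}

theorem ratio_pos {n : ℕ} {a : Fin (n+1) → ℝ} (ha : StrictAnti a) {x : Fin n → ℝ}
    (h : Inter a x) (j : Fin (n+1)) : 0 < (∏ i : Fin n, (a j - x i)) / D a j := by
  unfold D
  rw [← Finset.prod_div_distrib]
  exact Finset.prod_pos fun i _ => h.div_pos ha j i

theorem D_ne {n : ℕ} {a : Fin (n+1) → ℝ} (ha : StrictAnti a) (j : Fin (n+1)) : D a j ≠ 0 :=
  Finset.prod_ne_zero_iff.2 fun i _ => sub_ne_zero.2 fun h =>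
    (Fin.succAbove_ne j i) (ha.injective h).symm

theorem f_pos {n : ℕ} {a : Fin (n+1) → ℝ} (ha : StrictAnti a) {v : Fin (n+1) → ℝ} (h : v ∈ S a)
    (j : Fin (n+1)) : 0 < f a v j := by
  have := mul_pos (ratio_pos ha h.2 j) h.1
  have h2 : f a v j = (∏ i : Fin n, (a j - v i.succ)) / D a j * v 0 := by unfold f; ring
  rw [h2]; exact this

theorem sum_ratio {n : ℕ} {a : Fin (n+1) → ℝ} (ha : Function.Injective a) (x : Fin n → ℝ) :
    ∑ j, (∏ i : Fin n, (a j - x i)) / D a j = 1 := by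
  have hm : (∏ i, (X - C (x i))).Monic := monic_prod_of_monic _ _ fun i _ => monic_X_sub_C _
  have h := Lagrange.leadingCoeff_eq_sum (s := Finset.univ) (v := a) ha.injOn
    (P := ∏ i, (X - C (x i))) (by
      rw [Polynomial.degree_eq_natDegree hm.ne_zero,
        Polynomial.natDegree_finsetProd_X_sub_C_eq_card]
      simp)
  rw [hm.leadingCoeff] at h
  rw [h]
  refine Finset.sum_congr rfl fun j _ => ?_
  rw [D_eq, Polynomial.eval_prod]
  simp

theorem sum_f {n : ℕ} {a : Fin (n+1) → ℝ} (ha : Function.Injective a) (v : Fin (n+1) → ℝ) :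
    ∑ j, f a v j = v 0 := by
  have := sum_ratio ha (fun i => v i.succ)
  calc ∑ j, f a v j = (∑ j, (∏ i : Fin n, (a j - v i.succ)) / D a j) * v 0 := by
        rw [Finset.sum_mul]
        refine Finset.sum_congr rfl fun j _ => ?_
        unfold f; ring
    _ = v 0 := by rw [this, one_mul]

theorem inter_unique {n : ℕ} {a : Fin (n+1) → ℝ} (ha : StrictAnti a) {x y : Fin n → ℝ}
    (hx : Inter a x) (hy : Inter a y) {i k : Fin n} (h : x i = y k) : i = k := by
  rcases lt_trichotomy i k with hik | hik | hik
  · have h1 := hx.lt ha (j := k.castSucc) (i := i) (by simpa using hik)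
    have := (hy k).2
    linarith
  · exact hik
  · have h1 := hy.lt ha (j := i.castSucc) (i := k) (by simpa using hik)
    have := (hx i).2
    linarith

theorem f_inj {n : ℕ} {a : Fin (n+1) → ℝ} (ha : StrictAnti a) : Set.InjOn (f a) (S a) := by
  intro v hv w hw h
  have h0 : v 0 = w 0 := by rw [← sum_f ha.injective v, ← sum_f ha.injective w, h]
  have hP : (∏ i : Fin n, (X - C (v i.succ))) = ∏ i : Fin n, (X - C (w i.succ)) := by
    refine Polynomial.eq_of_degrees_lt_of_eval_index_eq (v := a) Finset.univ ha.injective.injOn ?_ ?_ ?_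
    · refine lt_of_le_of_lt Polynomial.degree_le_natDegree ?_
      rw [Polynomial.natDegree_finsetProd_X_sub_C_eq_card]
      simp
      exact_mod_cast Nat.lt_succ_self n
    · refine lt_of_le_of_lt Polynomial.degree_le_natDegree ?_
      rw [Polynomial.natDegree_finsetProd_X_sub_C_eq_card]
      simp
      exact_mod_cast Nat.lt_succ_self n
    · intro j _
      have hj := congrFun h j
      unfold f at hj
      rw [h0] at hj
      have := mul_right_cancel₀ (hw.1.ne') (mul_right_cancel₀ (inv_ne_zero (D_ne ha j)) hj)
      simpa [Polynomial.eval_prod] using this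
  funext j
  refine Fin.cases h0 (fun i => ?_) j
  have h1 := congrArg (Polynomial.eval (v i.succ)) hP
  simp only [Polynomial.eval_prod, eval_sub, eval_X, eval_C] at h1
  rw [Finset.prod_eq_zero (i := i) (by simp) (by simp)] at h1
  obtain ⟨k, _, hk⟩ := Finset.prod_eq_zero_iff.1 h1.symm
  have h2 : v i.succ = w k.succ := sub_eq_zero.1 hk
  have := inter_unique ha hv.2 hw.2 (i := i) (k := k) h2
  rw [h2, this]

theorem D_sign {n : ℕ} {a : Fin (n+1) → ℝ} (ha : StrictAnti a) (i : Fin n) :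
    D a i.castSucc * D a i.succ < 0 := by
  set m : Fin n → ℝ := fun i => (a i.succ + a i.castSucc) / 2 with hm
  have hI : Inter a m := fun i => by
    have := ha (Fin.castSucc_lt_succ (i := i))
    simp only [hm]; constructor <;> linarith
  have h1 := ratio_pos ha hI i.castSucc
  have h2 := ratio_pos ha hI i.succ
  have h3 : (∏ k : Fin n, (a i.castSucc - m k)) * (∏ k : Fin n, (a i.succ - m k)) < 0 := by
    rw [← Finset.prod_mul_distrib, ← Finset.mul_prod_erase _ _ (Finset.mem_univ i)]
    refine mul_neg_of_neg_of_pos ?_ (Finset.prod_pos fun k hk => ?_)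
    · exact mul_neg_of_pos_of_neg (sub_pos.2 (hI i).2) (sub_neg.2 (hI i).1)
    · have hk : k ≠ i := Finset.ne_of_mem_erase hk
      rcases lt_or_gt_of_ne hk with h | h
      · refine mul_pos_of_neg_of_neg (sub_neg.2 (hI.lt ha ?_)) (sub_neg.2 (hI.lt ha ?_))
        · simpa using h
        · exact lt_of_lt_of_le (by simpa using h) (Fin.castSucc_lt_succ (i := i)).le
      · refine mul_pos (sub_pos.2 (hI.gt ha ?_)) (sub_pos.2 (hI.gt ha ?_))
        · simpa using h.le
        · rw [← Fin.castSucc_lt_iff_succ_le]; simpa using h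
  have h4 := mul_pos h1 h2
  rw [div_mul_div_comm] at h4
  by_contra hc
  push Not at hc
  exact absurd h4 (not_lt.2 (div_nonpos_of_nonpos_of_nonneg h3.le hc))

theorem f_surj {n : ℕ} {a : Fin (n+1) → ℝ} (ha : StrictAnti a) {u : Fin (n+1) → ℝ}
    (hu : ∀ j, 0 < u j) : ∃ v ∈ S a, f a v = u := by
  set P : ℝ[X] := ∑ j, C (u j) * ∏ i : Fin n, (X - C (a (j.succAbove i))) with hP
  have hPa : ∀ j, P.eval (a j) = u j * D a j := by
    intro j
    rw [hP, Polynomial.eval_finsetSum, Finset.sum_eq_single j]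
    · simp [D, Polynomial.eval_prod]
    · intro k _ hk
      obtain ⟨i, hi⟩ := Fin.exists_succAbove_eq hk.symm
      rw [eval_mul, Polynomial.eval_prod, Finset.prod_eq_zero (i := i) (by simp) (by simp [hi]), mul_zero]
    · simp
  have hroot : ∀ i : Fin n, ∃ x, (a i.succ < x ∧ x < a i.castSucc) ∧ P.eval x = 0 := by
    intro i
    have hlt := ha (Fin.castSucc_lt_succ (i := i))
    have hs : P.eval (a i.castSucc) * P.eval (a i.succ) < 0 := by
      rw [hPa, hPa]
      have := mul_neg_of_pos_of_neg (mul_pos (hu i.castSucc) (hu i.succ)) (D_sign ha i)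
      linarith
    have hc : ContinuousOn (fun z => P.eval z) (Set.Icc (a i.succ) (a i.castSucc)) :=
      P.continuous.continuousOn
    rcases mul_neg_iff.1 hs with h | h
    · obtain ⟨x, hx, hx0⟩ := intermediate_value_Ioo hlt.le hc (show (0:ℝ) ∈ Set.Ioo _ _ from ⟨h.2, h.1⟩)
      exact ⟨x, hx, hx0⟩
    · obtain ⟨x, hx, hx0⟩ := intermediate_value_Ioo' hlt.le hc (show (0:ℝ) ∈ Set.Ioo _ _ from ⟨h.1, h.2⟩)
      exact ⟨x, hx, hx0⟩
  choose x hx hx0 using hroot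
  have hI : Inter a x := hx
  have hr : 0 < ∑ j, u j := Finset.sum_pos (fun j _ => hu j) Finset.univ_nonempty
  have hinj := (hI.strictAnti ha).injective
  -- compare polynomials
  have hdegQ : ∀ y : Fin n → ℝ, (∏ i, (X - C (y i))).natDegree = n := fun y => by
    rw [Polynomial.natDegree_finsetProd_X_sub_C_eq_card]; simp
  have hmon : ∀ y : Fin n → ℝ, (∏ i, (X - C (y i))).Monic := fun y =>
    monic_prod_of_monic _ _ fun i _ => monic_X_sub_C _
  have hco : ∀ y : Fin n → ℝ, (∏ i, (X - C (y i))).coeff n = 1 := fun y => by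
    have h1 := (hmon y).coeff_natDegree
    rw [hdegQ y] at h1
    exact h1
  have hEq : P = C (∑ j, u j) * ∏ i, (X - C (x i)) := by
    refine Polynomial.eq_of_degree_sub_lt_of_eval_index_eq (v := x) Finset.univ hinj.injOn ?_ ?_
    · rw [Finset.card_univ, Fintype.card_fin, Polynomial.degree_lt_iff_coeff_zero]
      intro m hm
      rw [coeff_sub, hP, Polynomial.finsetSum_coeff]
      simp only [coeff_C_mul]
      rcases hm.eq_or_lt with rfl | hm
      · have h1 : ∀ j : Fin (n+1), (∏ i : Fin n, (X - C (a (j.succAbove i)))).coeff n = 1 :=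
          fun j => hco _
        simp only [h1, hco]
        simp
      · have h1 : ∀ y : Fin n → ℝ, (∏ i, (X - C (y i))).coeff m = 0 := fun y =>
          Polynomial.coeff_eq_zero_of_natDegree_lt (by rw [hdegQ y]; exact hm)
        have h2 : ∀ j : Fin (n+1), (∏ i : Fin n, (X - C (a (j.succAbove i)))).coeff m = 0 :=
          fun j => h1 _
        simp only [h2, h1]
        simp
    · intro i _
      rw [hx0, eval_mul, Polynomial.eval_prod, Finset.prod_eq_zero (i := i) (by simp) (by simp), mul_zero]
  refine ⟨Fin.cons (∑ j, u j) x, ⟨by simpa using hr, by simpa using hI⟩, ?_⟩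
  funext j
  have h1 := hPa j
  rw [hEq, eval_mul, Polynomial.eval_prod] at h1
  simp only [eval_sub, eval_X, eval_C] at h1
  unfold f
  simp only [Fin.cons_succ, Fin.cons_zero]
  rw [mul_comm (∏ i, _), h1]
  field_simp [D_ne ha j]

theorem f_image {n : ℕ} {a : Fin (n+1) → ℝ} (ha : StrictAnti a) :
    f a '' S a = Set.univ.pi fun _ => Set.Ioi 0 := by
  ext u
  constructor
  · rintro ⟨v, hv, rfl⟩ j _
    exact f_pos ha hv j
  · intro h
    obtain ⟨v, hv, hv'⟩ := f_surj ha (u := u) (fun j => h j trivial)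
    exact ⟨v, hv, hv'⟩

/-- Jacobian matrix -/
noncomputable def J {n : ℕ} (a v : Fin (n+1) → ℝ) : Matrix (Fin (n+1)) (Fin (n+1)) ℝ :=
  Matrix.of fun j k => (D a j)⁻¹ * ((pp (fun i => v i.succ) k).eval (a j) *
    (Fin.cons 1 (fun _ => - v 0) : Fin (n+1) → ℝ) k)

theorem hasFDeriv_f {n : ℕ} (a v : Fin (n+1) → ℝ) :
    HasFDerivAt (f a) (LinearMap.toContinuousLinearMap (Matrix.toLin' (J a v))) v := by
  rw [hasFDerivAt_pi']
  intro j
  have h1 : ∀ i ∈ (Finset.univ : Finset (Fin n)), HasFDerivAt (fun v : Fin (n+1) → ℝ => a j - v i.succ)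
      (-(ContinuousLinearMap.proj (R := ℝ) (φ := fun _ : Fin (n+1) => ℝ) i.succ)) v := by
    intro i _
    exact (hasFDerivAt_apply i.succ v).const_sub (a j)
  have h2 := ((HasFDerivAt.finsetProd h1).mul (hasFDerivAt_apply 0 v)).mul_const ((D a j)⁻¹)
  refine h2.congr_fderiv ?_
  ext w
  simp [J, pp, Matrix.mulVec, dotProduct, Fin.sum_univ_succ, Polynomial.eval_prod, Finset.mul_sum]
  congr 1
  · ring
  · congr 1
    refine Finset.sum_congr rfl fun i _ => ?_
    ring

theorem det_J {n : ℕ} {a : Fin (n+1) → ℝ} (ha : StrictAnti a) {v : Fin (n+1) → ℝ} (hv : v ∈ S a) :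
    |(LinearMap.toContinuousLinearMap (Matrix.toLin' (J a v))).det|
      = v 0 ^ n * V (fun i => v i.succ) / V a := by
  have hJ : (LinearMap.toContinuousLinearMap (Matrix.toLin' (J a v))).det = (J a v).det := by
    rw [ContinuousLinearMap.det, LinearMap.coe_toContinuousLinearMap, LinearMap.det_toLin']
  rw [hJ]
  unfold J
  have e1 := Matrix.det_mul_column (fun j => (D a j)⁻¹) (Matrix.of fun j k => ((pp (fun i => v i.succ) k).eval (a j) *
    (Fin.cons 1 (fun _ => - v 0) : Fin (n+1) → ℝ) k))
  have e2 := Matrix.det_mul_row (Fin.cons 1 (fun _ => - v 0) : Fin (n+1) → ℝ)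
    (Matrix.of fun j k => ((pp (fun i => v i.succ) k).eval (a j)))
  simp only [Matrix.of_apply] at e1 e2
  have e3 : (Matrix.of fun j k => ((pp (fun i => v i.succ) k).eval (a j) *
    (Fin.cons 1 (fun _ => - v 0) : Fin (n+1) → ℝ) k)) = (Matrix.of fun j k =>
    (Fin.cons 1 (fun _ => - v 0) : Fin (n+1) → ℝ) k * ((pp (fun i => v i.succ) k).eval (a j))) := by
    ext j k; simp [mul_comm]
  rw [e1, e3, e2, abs_mul, abs_mul, det_N _ ((hv.2.strictAnti ha).injective), Finset.abs_prod, Finset.abs_prod]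
  simp only [abs_inv]
  rw [Finset.prod_inv_distrib, prod_D, Fin.prod_univ_succ]
  have := V_pos ha.injective
  simp [abs_of_pos hv.1]
  field_simp

end Selb


namespace Selb
open Finset

theorem V_cont {n : ℕ} : Continuous (V : (Fin n → ℝ) → ℝ) := by
  unfold V
  refine continuous_finsetProd _ fun i _ => continuous_finsetProd _ fun j _ => ?_
  split_ifs <;> fun_prop

theorem V_meas {n : ℕ} : Measurable (V : (Fin n → ℝ) → ℝ) := V_cont.measurable

theorem gamma_one {s : ℝ} (hs : 0 < s) :
    ∫⁻ r in Set.Ioi (0:ℝ), ENNReal.ofReal (Real.exp (-r) * r ^ (s - 1)) = ENNReal.ofReal (Real.Gamma s) := by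
  rw [Real.Gamma_eq_integral hs, ofReal_integral_eq_lintegral_ofReal]
  · exact Real.GammaIntegral_convergent hs
  · filter_upwards [ae_restrict_mem measurableSet_Ioi] with r hr
    have : (0:ℝ) < r := hr
    simp only [Pi.zero_apply]
    positivity

theorem gamma_orthant {m : ℕ} {s : Fin m → ℝ} (hs : ∀ j, 0 < s j) :
    ∫⁻ u in Set.univ.pi (fun _ : Fin m => Set.Ioi (0:ℝ)),
      ENNReal.ofReal (∏ j, (Real.exp (-u j) * u j ^ (s j - 1))) = ENNReal.ofReal (∏ j, Real.Gamma (s j)) := by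
  have h0 : (∏ j, Real.Gamma (s j)) = ∫ u in Set.univ.pi (fun _ : Fin m => Set.Ioi (0:ℝ)),
      (∏ j, (Real.exp (-u j) * u j ^ (s j - 1))) := by
    rw [volume_pi, Measure.restrict_pi_pi,
      integral_fintype_prod_eq_prod (fun j x => Real.exp (-x) * x ^ (s j - 1))]
    exact Finset.prod_congr rfl fun j _ => Real.Gamma_eq_integral (hs j)
  rw [h0, ofReal_integral_eq_lintegral_ofReal]
  · rw [volume_pi, Measure.restrict_pi_pi]
    exact Integrable.fintype_prod (f := fun j x => Real.exp (-x) * x ^ (s j - 1))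
      (fun j => Real.GammaIntegral_convergent (hs j))
  · filter_upwards [ae_restrict_mem (MeasurableSet.univ_pi fun _ => measurableSet_Ioi)] with u hu
    refine Finset.prod_nonneg fun j _ => ?_
    have : (0:ℝ) < u j := hu j trivial
    positivity

theorem I_meas {n : ℕ} (a : Fin (n+1) → ℝ) : MeasurableSet {x | Inter a x} := by
  unfold Inter
  simp only [Set.ofPred_forall]
  refine MeasurableSet.iInter fun i => ?_
  exact (measurableSet_lt measurable_const (measurable_pi_apply i)).inter
    (measurableSet_lt (measurable_pi_apply i) measurable_const)

theorem S_eq {n : ℕ} (a : Fin (n+1) → ℝ) :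
    S a = (MeasurableEquiv.piFinSuccAbove (fun _ : Fin (n+1) => ℝ) 0) ⁻¹' (Set.Ioi 0 ×ˢ {x | Inter a x}) := by
  ext v
  simp [S, Inter, MeasurableEquiv.piFinSuccAbove, Fin.tail, Fin.insertNthEquiv]

theorem S_meas {n : ℕ} (a : Fin (n+1) → ℝ) : MeasurableSet (S a) := by
  rw [S_eq]
  exact (MeasurableEquiv.measurable _) (measurableSet_Ioi.prod (I_meas a))

theorem lint_S {n : ℕ} (a : Fin (n+1) → ℝ) (G : ℝ → ENNReal) (H : (Fin n → ℝ) → ENNReal)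
    (hG : Measurable G) (hH : Measurable H) :
    ∫⁻ v in S a, G (v 0) * H (fun i => v i.succ) =
      (∫⁻ r in Set.Ioi 0, G r) * ∫⁻ x in {x | Inter a x}, H x := by
  have mp := volume_preserving_piFinSuccAbove (fun _ : Fin (n+1) => ℝ) 0
  have h := mp.setLIntegral_comp_preimage_emb (MeasurableEquiv.measurableEmbedding _)
    (fun p => G p.1 * H p.2) (Set.Ioi 0 ×ˢ {x | Inter a x})
  rw [← S_eq, Measure.volume_eq_prod, ← Measure.prod_restrict,
    lintegral_prod_mul hG.aemeasurable hH.aemeasurable] at h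
  rw [← h]
  rfl

/-- Dixon–Anderson integrand. -/
noncomputable def DAi {n : ℕ} (a s : Fin (n+1) → ℝ) (x : Fin n → ℝ) : ℝ :=
  V x * ∏ j, ∏ i, |a j - x i| ^ (s j - 1)

theorem DAi_nonneg {n : ℕ} (a s : Fin (n+1) → ℝ) (x : Fin n → ℝ) : 0 ≤ DAi a s x := by
  have := V_nonneg x
  unfold DAi
  positivity

theorem DAi_meas {n : ℕ} (a s : Fin (n+1) → ℝ) : Measurable (DAi a s) := by
  unfold DAi
  have := V_meas (n := n)
  fun_prop

theorem pointwise {n : ℕ} {a : Fin (n+1) → ℝ} (ha : StrictAnti a) (s : Fin (n+1) → ℝ)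
    {v : Fin (n+1) → ℝ} (hv : v ∈ S a) :
    (v 0 ^ n * V (fun i => v i.succ) / V a) * ∏ j, (Real.exp (-f a v j) * f a v j ^ (s j - 1))
      = (Real.exp (-v 0) * v 0 ^ (∑ j, s j - 1)) *
        (DAi a s (fun i => v i.succ) * (V a * ∏ j, |D a j| ^ (s j - 1))⁻¹) := by
  have h0 : 0 < v 0 := hv.1
  have hVa := V_pos ha.injective
  rw [Finset.prod_mul_distrib, ← Real.exp_sum, Finset.sum_neg_distrib, sum_f ha.injective]
  have h1 : ∀ j, f a v j ^ (s j - 1) =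
      (∏ i : Fin n, |a j - v i.succ| ^ (s j - 1)) * v 0 ^ (s j - 1) * (|D a j| ^ (s j - 1))⁻¹ := by
    intro j
    rw [← abs_of_pos (f_pos ha hv j), f, abs_mul, abs_mul, abs_of_pos h0, Finset.abs_prod,
      Real.mul_rpow (by positivity) (by positivity), Real.mul_rpow (by positivity) (by positivity),
      abs_inv, Real.inv_rpow (by positivity), Real.finsetProd_rpow _ _ (fun i _ => by positivity)]
  have h2 : v 0 ^ (∑ j, s j - 1) = v 0 ^ n * ∏ j, v 0 ^ (s j - 1) := by
    rw [← Real.rpow_sum_of_pos h0, ← Real.rpow_natCast, ← Real.rpow_add h0]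
    congr 1
    rw [Finset.sum_sub_distrib]
    simp
    ring
  simp only [h1]
  rw [Finset.prod_mul_distrib, Finset.prod_mul_distrib, Finset.prod_inv_distrib, h2, DAi, mul_inv]
  ring

theorem dixon_anderson {n : ℕ} {a s : Fin (n+1) → ℝ} (ha : StrictAnti a) (hs : ∀ j, 0 < s j) :
    ∫⁻ x in {x | Inter a x}, ENNReal.ofReal (DAi a s x) =
      ENNReal.ofReal ((∏ j, Real.Gamma (s j)) / Real.Gamma (∑ j, s j) *
        (V a * ∏ j, |D a j| ^ (s j - 1))) := by
  set K := V a * ∏ j, |D a j| ^ (s j - 1) with hK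
  have hKpos : 0 < K := by
    have := V_pos ha.injective
    have h2 : ∀ j, 0 < |D a j| := fun j => abs_pos.2 (D_ne ha j)
    exact mul_pos this (Finset.prod_pos fun j _ => Real.rpow_pos_of_pos (h2 j) _)
  have hsum : 0 < ∑ j, s j := Finset.sum_pos (fun j _ => hs j) Finset.univ_nonempty
  have hG := Real.Gamma_pos_of_pos hsum
  have h := lintegral_image_eq_lintegral_abs_det_fderiv_mul volume (S_meas a)
    (fun v _ => (hasFDeriv_f a v).hasFDerivWithinAt) (f_inj ha)
    (fun u => ENNReal.ofReal (∏ j, (Real.exp (-u j) * u j ^ (s j - 1))))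
  rw [f_image ha, gamma_orthant hs] at h
  have h2 : ∫⁻ v in S a, ENNReal.ofReal |(LinearMap.toContinuousLinearMap (Matrix.toLin' (J a v))).det| *
      ENNReal.ofReal (∏ j, (Real.exp (-f a v j) * f a v j ^ (s j - 1))) =
      ∫⁻ v in S a, ENNReal.ofReal (Real.exp (-v 0) * v 0 ^ (∑ j, s j - 1)) *
        (ENNReal.ofReal (DAi a s (fun i => v i.succ)) * ENNReal.ofReal K⁻¹) := by
    refine setLIntegral_congr_fun (S_meas a) fun v hv => ?_
    have h0 : 0 < v 0 := hv.1
    rw [← ENNReal.ofReal_mul (abs_nonneg _), det_J ha hv, pointwise ha s hv, ← ENNReal.ofReal_mul (DAi_nonneg _ _ _),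
      ← ENNReal.ofReal_mul (by positivity)]
  rw [h2, lint_S a (fun r => ENNReal.ofReal (Real.exp (-r) * r ^ (∑ j, s j - 1)))
    (fun x => ENNReal.ofReal (DAi a s x) * ENNReal.ofReal K⁻¹) (by fun_prop)
    ((DAi_meas a s).ennreal_ofReal.mul_const _), gamma_one hsum,
    lintegral_mul_const _ (DAi_meas a s).ennreal_ofReal] at h
  have h3 : ENNReal.ofReal (Real.Gamma (∑ j, s j)) * ENNReal.ofReal K⁻¹ *
      ENNReal.ofReal (K / Real.Gamma (∑ j, s j)) = 1 := by
    rw [← ENNReal.ofReal_mul (by positivity), ← ENNReal.ofReal_mul (by positivity), ENNReal.ofReal_eq_one]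
    field_simp
  calc _ = (∫⁻ x in {x | Inter a x}, ENNReal.ofReal (DAi a s x)) * 1 := by rw [mul_one]
    _ = (ENNReal.ofReal (∏ j, Real.Gamma (s j))) * ENNReal.ofReal (K / Real.Gamma (∑ j, s j)) := by
      rw [← h3, h]; ring
    _ = _ := by
      rw [← ENNReal.ofReal_mul (Finset.prod_nonneg fun j _ => (Real.Gamma_pos_of_pos (hs j)).le)]
      congr 1; ring

end Selb


namespace Selb
open Finset

/-- weight -/
noncomputable def W {n : ℕ} (α β : ℝ) (t : Fin n → ℝ) : ℝ :=
  ∏ j, (t j) ^ (α - 1) * (1 - t j) ^ (β - 1)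

/-- open ordered simplex -/
def O (n : ℕ) : Set (Fin n → ℝ) := {t | StrictAnti t ∧ ∀ i, 0 < t i ∧ t i < 1}

/-- the ordered Selberg integral as a Lebesgue integral -/
noncomputable def Sel (n : ℕ) (α β γ : ℝ) : ENNReal :=
  ∫⁻ t in O n, ENNReal.ofReal (W α β t * V t ^ (2 * γ))

/-- extended nodes -/
noncomputable def ext {n : ℕ} (b : ℝ) (y : Fin n → ℝ) (c : ℝ) : Fin (n+2) → ℝ :=
  Fin.cons b (Fin.snoc y c : Fin (n+1) → ℝ)

theorem inter_ext {n : ℕ} (x : Fin (n+1) → ℝ) (y : Fin n → ℝ) :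
    Inter (ext 1 y 0) x ↔ Inter x y ∧ 0 < x (Fin.last n) ∧ x 0 < 1 := by
  unfold Inter
  rw [forall_and, forall_and]
  have h1 : (∀ i : Fin (n+1), ext 1 y 0 i.succ < x i) ↔
      (∀ i : Fin n, y i < x i.castSucc) ∧ 0 < x (Fin.last n) := by
    rw [Fin.forall_fin_succ']
    simp [ext]
  have h2 : (∀ i : Fin (n+1), x i < ext 1 y 0 i.castSucc) ↔
      x 0 < 1 ∧ (∀ i : Fin n, x i.succ < y i) := by
    rw [ext, Fin.cons_snoc_eq_snoc_cons, Fin.forall_fin_succ]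
    simp only [Fin.snoc_castSucc, Fin.cons_zero, Fin.cons_succ]
  rw [h1, h2]
  tauto

theorem O_inter {n : ℕ} (x : Fin (n+1) → ℝ) (y : Fin n → ℝ) :
    (x ∈ O (n+1) ∧ Inter x y) ↔ Inter (ext 1 y 0) x := by
  rw [inter_ext]
  constructor
  · rintro ⟨h, h2⟩
    exact ⟨h2, (h.2 _).1, (h.2 _).2⟩
  · rintro ⟨h, h0, h1⟩
    have hx : StrictAnti x := Fin.strictAnti_iff_succ_lt.2 fun i => (h i).1.trans (h i).2
    refine ⟨⟨hx, fun i => ⟨?_, ?_⟩⟩, h⟩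
    · exact lt_of_lt_of_le h0 (hx.antitone (Fin.le_last i))
    · exact lt_of_le_of_lt (hx.antitone (Fin.zero_le i)) h1

theorem O_of_inter {n : ℕ} {x : Fin (n+1) → ℝ} {y : Fin n → ℝ} (h : Inter (ext 1 y 0) x) :
    y ∈ O n := by
  obtain ⟨hx, hxy⟩ := (O_inter x y).2 h
  refine ⟨hxy.strictAnti hx.1, fun i => ⟨?_, ?_⟩⟩
  · exact (hx.2 _).1.trans (hxy i).1
  · exact (hxy i).2.trans (hx.2 _).2

theorem ext_anti {n : ℕ} {y : Fin n → ℝ} (h : y ∈ O n) : StrictAnti (ext 1 y 0) := by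
  intro i j
  refine Fin.cases ?_ (fun i => ?_) i <;> refine Fin.cases ?_ (fun j => ?_) j
  · simp
  · refine Fin.lastCases ?_ (fun j => ?_) j
    · simp [ext]
    · simp [ext, (h.2 j).2]
  · simp
  · refine Fin.lastCases ?_ (fun j => ?_) j <;> refine Fin.lastCases ?_ (fun i => ?_) i
    · simp
    · simp [ext, (h.2 i).1]
    · intro hh
      exact absurd (Fin.succ_lt_succ_iff.1 hh) (not_lt.2 (Fin.le_last _))
    · simp only [ext, Fin.cons_succ, Fin.snoc_castSucc, Fin.succ_lt_succ_iff, Fin.castSucc_lt_castSucc_iff]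
      exact fun hh => h.1 hh

theorem abs_D {n : ℕ} (a : Fin (n+1) → ℝ) (j : Fin (n+1)) :
    |D a j| = ∏ l, if l = j then 1 else |a j - a l| := by
  rw [D_eq, Finset.abs_prod, ← Finset.mul_prod_erase _ _ (Finset.mem_univ j)]
  simp only [if_true, one_mul]
  exact Finset.prod_congr rfl fun l hl => by rw [if_neg (Finset.ne_of_mem_erase hl)]

/-- off-diagonal product -/
noncomputable def E {n : ℕ} (y : Fin n → ℝ) (k : Fin n) : ℝ := ∏ l, if l = k then 1 else |y k - y l|

theorem prod_E {n : ℕ} (y : Fin n → ℝ) : ∏ k, E y k = V y ^ 2 := by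
  rw [← prod_off]
  refine Finset.prod_congr rfl fun j _ => ?_
  unfold E
  rw [← Finset.mul_prod_erase _ _ (Finset.mem_univ j)]
  simp only [if_true, one_mul]
  exact Finset.prod_congr rfl fun l hl => by rw [if_neg (Finset.ne_of_mem_erase hl)]

theorem E_nonneg {n : ℕ} (y : Fin n → ℝ) (k : Fin n) : 0 ≤ E y k := by
  unfold E
  refine Finset.prod_nonneg fun l _ => ?_
  split_ifs <;> positivity

theorem K_const {n : ℕ} {x : Fin (n+1) → ℝ} (hx : StrictAnti x) (γ : ℝ) :
    V x * (V x * ∏ j, |D x j| ^ (γ - 1)) = V x ^ (2 * γ) := by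
  have h := V_pos hx.injective
  rw [Real.finsetProd_rpow _ _ (fun j _ => abs_nonneg _), prod_D, ← Real.rpow_natCast,
    ← Real.rpow_mul h.le, ← mul_assoc]
  nth_rewrite 1 2 [← Real.rpow_one (V x)]
  rw [← Real.rpow_add h, ← Real.rpow_add h]
  congr 1
  push_cast
  ring

theorem K_ext {n : ℕ} {y : Fin n → ℝ} (hy : y ∈ O n) (α β γ : ℝ) :
    V y * (V (ext 1 y 0) * ∏ j, |D (ext 1 y 0) j| ^ (ext β (fun _ => γ) α j - 1)) =
      W (α + γ) (β + γ) y * V y ^ (2 * γ) := by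
  have h := V_pos hy.1.injective
  have hD0 : |D (ext 1 y 0) 0| = ∏ i, (1 - y i) := by
    rw [abs_D, Fin.prod_univ_succ, Fin.prod_univ_castSucc]
    simp [ext]
    exact Finset.prod_congr rfl fun i _ => abs_of_pos (sub_pos.2 (hy.2 i).2)
  have hDl : |D (ext 1 y 0) (Fin.last n).succ| = ∏ i, y i := by
    rw [abs_D, Fin.prod_univ_succ, Fin.prod_univ_castSucc]
    simp only [ext, Fin.cons_zero, Fin.cons_succ, Fin.snoc_last, Fin.snoc_castSucc]
    simp
    exact Finset.prod_congr rfl fun i _ => abs_of_pos (hy.2 i).1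
  have hDm : ∀ k : Fin n, |D (ext 1 y 0) k.castSucc.succ| = (1 - y k) * y k * E y k := by
    intro k
    rw [abs_D, Fin.prod_univ_succ, Fin.prod_univ_castSucc]
    simp only [ext, Fin.cons_zero, Fin.cons_succ, Fin.snoc_last, Fin.snoc_castSucc, Fin.succ_inj,
      Fin.castSucc_inj]
    rw [if_neg (Fin.succ_ne_zero _).symm, if_neg (Fin.castSucc_lt_last k).ne', sub_zero,
      abs_of_pos (hy.2 k).1, abs_sub_comm, abs_of_pos (sub_pos.2 (hy.2 k).2)]
    unfold E
    ring
  have hV : V (ext 1 y 0) = (∏ i, (1 - y i)) * (∏ i, y i) * V y := by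
    rw [ext, V_cons, V_snoc, Fin.prod_univ_castSucc]
    simp only [Fin.snoc_last, Fin.snoc_castSucc, sub_zero, abs_one, mul_one]
    rw [Finset.prod_congr rfl fun i _ => abs_of_pos (sub_pos.2 (hy.2 i).2),
      Finset.prod_congr rfl fun i _ => abs_of_pos (hy.2 i).1]
    ring
  rw [Fin.prod_univ_succ, Fin.prod_univ_castSucc, hD0, hDl, hV]
  simp only [hDm]
  simp only [ext, Fin.cons_zero, Fin.cons_succ, Fin.snoc_last, Fin.snoc_castSucc]
  rw [Real.finsetProd_rpow _ _ (fun k _ => mul_nonneg (mul_nonneg (sub_pos.2 (hy.2 k).2).le (hy.2 k).1.le)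
    (E_nonneg y k)), Finset.prod_mul_distrib, Finset.prod_mul_distrib, prod_E]
  unfold W
  have hA : 0 < ∏ i, (1 - y i) := Finset.prod_pos fun i _ => sub_pos.2 (hy.2 i).2
  have hB : 0 < ∏ i, y i := Finset.prod_pos fun i _ => (hy.2 i).1
  rw [Finset.prod_mul_distrib, Real.finsetProd_rpow _ _ (fun k _ => (hy.2 k).1.le),
    Real.finsetProd_rpow _ _ (fun k _ => (sub_pos.2 (hy.2 k).2).le)]
  generalize (∏ i, (1 - y i)) = A at *
  generalize (∏ i, y i) = B at *
  generalize V y = v at *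
  rw [Real.mul_rpow (by positivity) (by positivity), Real.mul_rpow (by positivity) (by positivity)]
  have e1 : A ^ (β + γ - 1) = A * A ^ (β - 1) * A ^ (γ - 1) := by
    nth_rewrite 2 [← Real.rpow_one A]
    rw [← Real.rpow_add hA, ← Real.rpow_add hA]; congr 1; ring
  have e2 : B ^ (α + γ - 1) = B * B ^ (α - 1) * B ^ (γ - 1) := by
    nth_rewrite 2 [← Real.rpow_one B]
    rw [← Real.rpow_add hB, ← Real.rpow_add hB]; congr 1; ring
  have e3 : v ^ (2 * γ) = v * v * (v ^ 2) ^ (γ - 1) := by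
    rw [← Real.rpow_natCast, ← Real.rpow_mul h.le]
    nth_rewrite 2 3 [← Real.rpow_one v]
    rw [← Real.rpow_add h, ← Real.rpow_add h]; congr 1; push_cast; ring
  rw [e1, e2, e3]
  ring

theorem O_meas (n : ℕ) : MeasurableSet (O n) := by
  have : O n = (⋂ i, ⋂ j, {t : Fin n → ℝ | i < j → t j < t i}) ∩ ⋂ i, {t | 0 < t i ∧ t i < 1} := by
    ext t
    simp [O, StrictAnti]
  rw [this]
  refine MeasurableSet.inter (MeasurableSet.iInter fun i => MeasurableSet.iInter fun j => ?_)
    (MeasurableSet.iInter fun i => ?_)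
  · by_cases h : i < j
    · simp only [h, true_imp_iff]
      exact measurableSet_lt (measurable_pi_apply _) (measurable_pi_apply _)
    · simp [h]
  · exact (measurableSet_lt measurable_const (measurable_pi_apply i)).inter
      (measurableSet_lt (measurable_pi_apply i) measurable_const)

theorem W_meas {n : ℕ} (α β : ℝ) : Measurable (W α β : (Fin n → ℝ) → ℝ) := by
  unfold W; fun_prop

theorem W_nonneg {n : ℕ} (α β : ℝ) {t : Fin n → ℝ} (ht : t ∈ O n) : 0 ≤ W α β t := by
  refine Finset.prod_nonneg fun i _ => mul_nonneg ?_ ?_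
  · exact Real.rpow_nonneg (ht.2 i).1.le _
  · exact Real.rpow_nonneg (sub_pos.2 (ht.2 i).2).le _

/-- the joint integrand -/
noncomputable def hh {n : ℕ} (α β γ : ℝ) (x : Fin (n+1) → ℝ) (y : Fin n → ℝ) : ℝ :=
  W α β x * V x * V y * ∏ j, ∏ i, |x j - y i| ^ (γ - 1)

theorem hh_left {n : ℕ} (α β γ : ℝ) (x : Fin (n+1) → ℝ) (y : Fin n → ℝ) :
    hh α β γ x y = (W α β x * V x) * DAi x (fun _ => γ) y := by
  unfold hh DAi; ring

theorem hh_right {n : ℕ} (α β γ : ℝ) (x : Fin (n+1) → ℝ) (hx : x ∈ O (n+1)) (y : Fin n → ℝ) :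
    hh α β γ x y = V y * DAi (ext 1 y 0) (ext β (fun _ => γ) α) x := by
  unfold hh DAi W
  rw [Fin.prod_univ_succ (f := fun j => ∏ i, |ext 1 y 0 j - x i| ^ _), Fin.prod_univ_castSucc (n := n) (f := fun j => ∏ i, |ext 1 y 0 j.succ - x i| ^ _)]
  simp only [ext, Fin.cons_zero, Fin.cons_succ, Fin.snoc_last, Fin.snoc_castSucc]
  have h1 : ∀ i, |1 - x i| = 1 - x i := fun i => abs_of_pos (sub_pos.2 (hx.2 i).2)
  have h2 : ∀ i, |0 - x i| = x i := fun i => by rw [zero_sub, abs_neg, abs_of_pos (hx.2 i).1]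
  simp only [h1, h2]
  rw [Finset.prod_mul_distrib, Finset.prod_comm]
  have h3 : ∀ i j, |x j - y i| = |y i - x j| := fun i j => abs_sub_comm _ _
  simp only [h3]
  ring

theorem T_meas (n : ℕ) : MeasurableSet {p : (Fin (n+1) → ℝ) × (Fin n → ℝ) | Inter (ext 1 p.2 0) p.1} := by
  simp only [inter_ext]
  refine MeasurableSet.inter ?_ (MeasurableSet.inter ?_ ?_)
  · have : {p : (Fin (n+1) → ℝ) × (Fin n → ℝ) | ∀ i : Fin n, p.1 i.succ < p.2 i ∧ p.2 i < p.1 i.castSucc}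
      = ⋂ i : Fin n, {p : (Fin (n+1) → ℝ) × (Fin n → ℝ) | p.1 i.succ < p.2 i} ∩ {p | p.2 i < p.1 i.castSucc} := by
      ext p; simp
    change MeasurableSet {p : (Fin (n+1) → ℝ) × (Fin n → ℝ) | ∀ i : Fin n, p.1 i.succ < p.2 i ∧ p.2 i < p.1 i.castSucc}
    rw [this]
    refine MeasurableSet.iInter fun i => MeasurableSet.inter ?_ ?_
    · exact measurableSet_lt (by fun_prop) (by fun_prop)
    · exact measurableSet_lt (by fun_prop) (by fun_prop)
  · exact measurableSet_lt (f := fun _ => (0:ℝ)) (g := fun p : (Fin (n+1) → ℝ) × (Fin n → ℝ) => p.1 (Fin.last n)) (by fun_prop) (by fun_prop)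
  · exact measurableSet_lt (f := fun p : (Fin (n+1) → ℝ) × (Fin n → ℝ) => p.1 0) (g := fun _ => (1:ℝ)) (by fun_prop) (by fun_prop)

theorem step {n : ℕ} {α β γ : ℝ} (hα : 0 < α) (hβ : 0 < β) (hγ : 0 < γ) :
    ENNReal.ofReal (Real.Gamma γ ^ (n+1) / Real.Gamma ((n+1) * γ)) * Sel (n+1) α β γ =
    ENNReal.ofReal (Real.Gamma α * Real.Gamma β * Real.Gamma γ ^ n / Real.Gamma (α + β + n * γ)) *
      Sel n (α + γ) (β + γ) γ := by
  set T := {p : (Fin (n+1) → ℝ) × (Fin n → ℝ) | Inter (ext 1 p.2 0) p.1} with hT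
  set Φ : (Fin (n+1) → ℝ) → (Fin n → ℝ) → ENNReal := fun x y =>
    T.indicator (fun p => ENNReal.ofReal (hh α β γ p.1 p.2)) (x, y) with hΦ
  have hmeas : Measurable (Function.uncurry Φ) := by
    have : Function.uncurry Φ = T.indicator (fun p => ENNReal.ofReal (hh α β γ p.1 p.2)) := by
      ext p; rfl
    rw [this]
    refine Measurable.indicator ?_ (T_meas n)
    unfold hh
    have h1 := V_meas (n := n)
    have h2 := V_meas (n := n+1)
    have h3 := W_meas (n := n+1) α β
    fun_prop
  have hswap := lintegral_lintegral_swap (μ := volume) (ν := volume) hmeas.aemeasurable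
  have hV1 := V_meas (n := n)
  have hV2 := V_meas (n := n+1)
  -- left side
  have hL : ∀ x, ∫⁻ y, Φ x y = (O (n+1)).indicator (fun x =>
      ENNReal.ofReal (Real.Gamma γ ^ (n+1) / Real.Gamma ((n+1) * γ)) *
        ENNReal.ofReal (W α β x * V x ^ (2 * γ))) x := by
    intro x
    by_cases hx : x ∈ O (n+1)
    · rw [Set.indicator_of_mem hx]
      have e1 : ∀ y, Φ x y = {y | Inter x y}.indicator
          (fun y => ENNReal.ofReal (W α β x * V x) * ENNReal.ofReal (DAi x (fun _ => γ) y)) y := by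
        intro y
        simp only [hΦ]
        have hiff : (x, y) ∈ T ↔ y ∈ {y | Inter x y} := by
          change Inter (ext 1 y 0) x ↔ Inter x y
          rw [← O_inter]; exact ⟨fun h => h.2, fun h => ⟨hx, h⟩⟩
        by_cases hy : y ∈ {y | Inter x y}
        · rw [Set.indicator_of_mem hy, Set.indicator_of_mem (hiff.2 hy), hh_left,
            ENNReal.ofReal_mul (mul_nonneg (W_nonneg α β hx) (V_nonneg x))]
        · rw [Set.indicator_of_notMem hy, Set.indicator_of_notMem (fun h => hy (hiff.1 h))]
      simp_rw [e1]
      rw [lintegral_indicator (I_meas x), lintegral_const_mul _ (DAi_meas _ _).ennreal_ofReal,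
        dixon_anderson hx.1 (fun _ => hγ), ← ENNReal.ofReal_mul (mul_nonneg (W_nonneg α β hx) (V_nonneg x)),
        ← ENNReal.ofReal_mul (by
          have := Real.Gamma_pos_of_pos hγ
          have := Real.Gamma_pos_of_pos (show 0 < ((n:ℝ)+1) * γ by positivity)
          positivity)]
      congr 1
      rw [← K_const hx.1 γ]
      simp
      ring
    · rw [Set.indicator_of_notMem hx]
      refine lintegral_eq_zero_of_ae_eq_zero (Filter.Eventually.of_forall fun y => ?_)
      simp only [hΦ]
      exact Set.indicator_of_notMem (fun h => hx ((O_inter x y).2 h).1) _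
  have hR : ∀ y, ∫⁻ x, Φ x y = (O n).indicator (fun y =>
      ENNReal.ofReal (Real.Gamma α * Real.Gamma β * Real.Gamma γ ^ n / Real.Gamma (α + β + n * γ)) *
        ENNReal.ofReal (W (α + γ) (β + γ) y * V y ^ (2 * γ))) y := by
    intro y
    by_cases hy : y ∈ O n
    · rw [Set.indicator_of_mem hy]
      have e1 : ∀ x, Φ x y = {x | Inter (ext 1 y 0) x}.indicator
          (fun x => ENNReal.ofReal (V y) * ENNReal.ofReal (DAi (ext 1 y 0) (ext β (fun _ => γ) α) x)) x := by
        intro x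
        simp only [hΦ]
        have hiff : (x, y) ∈ T ↔ x ∈ {x | Inter (ext 1 y 0) x} := Iff.rfl
        by_cases hx : x ∈ {x | Inter (ext 1 y 0) x}
        · rw [Set.indicator_of_mem hx, Set.indicator_of_mem (hiff.2 hx),
            hh_right _ _ _ _ ((O_inter x y).2 hx).1,
            ENNReal.ofReal_mul (V_nonneg y)]
        · rw [Set.indicator_of_notMem hx, Set.indicator_of_notMem (fun h => hx (hiff.1 h))]
      simp_rw [e1]
      have hs : ∀ j, 0 < ext β (fun _ : Fin n => γ) α j := by
        intro j
        refine Fin.cases hβ (fun j => ?_) j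
        refine Fin.lastCases ?_ (fun j => ?_) j
        · simpa [ext] using hα
        · simpa [ext] using hγ
      rw [lintegral_indicator (I_meas _), lintegral_const_mul _ (DAi_meas _ _).ennreal_ofReal,
        dixon_anderson (ext_anti hy) hs, ← ENNReal.ofReal_mul (V_nonneg y),
        ← ENNReal.ofReal_mul (by
          have := Real.Gamma_pos_of_pos hγ
          have := Real.Gamma_pos_of_pos hα
          have := Real.Gamma_pos_of_pos hβ
          have := Real.Gamma_pos_of_pos (show 0 < α + β + n * γ by positivity)
          positivity)]
      congr 1
      rw [← K_ext hy α β γ]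
      have hsum : ∑ j, ext β (fun _ : Fin n => γ) α j = α + β + n * γ := by
        rw [Fin.sum_univ_succ, Fin.sum_univ_castSucc]
        simp [ext]; ring
      have hprod : ∏ j, Real.Gamma (ext β (fun _ : Fin n => γ) α j) =
          Real.Gamma α * Real.Gamma β * Real.Gamma γ ^ n := by
        rw [Fin.prod_univ_succ, Fin.prod_univ_castSucc]
        simp [ext]; ring
      rw [hsum, hprod]
      ring
    · rw [Set.indicator_of_notMem hy]
      refine lintegral_eq_zero_of_ae_eq_zero (Filter.Eventually.of_forall fun x => ?_)
      simp only [hΦ]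
      exact Set.indicator_of_notMem (fun h => hy (O_of_inter h)) _
  simp_rw [hL, hR] at hswap
  rw [lintegral_indicator (O_meas _), lintegral_indicator (O_meas _),
    lintegral_const_mul _ (by
      have h3 := W_meas (n := n+1) α β
      fun_prop),
    lintegral_const_mul _ (by
      have h3 := W_meas (n := n) (α+γ) (β+γ)
      fun_prop)] at hswap
  exact hswap

/-- right-hand side -/
noncomputable def rhs (p : ℕ) (α β γ : ℝ) : ℝ :=
  (1 / (Nat.factorial p : ℝ)) * ∏ j ∈ Finset.range p,
        (Real.Gamma (1 + γ + j * γ) * Real.Gamma (α + j * γ) * Real.Gamma (β + j * γ)) /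
          (Real.Gamma (1 + γ) * Real.Gamma (α + β + ((p : ℝ) + j - 1) * γ))

theorem rhs_nonneg (p : ℕ) {α β γ : ℝ} (hα : 0 < α) (hβ : 0 < β) (hγ : 0 ≤ γ) : 0 ≤ rhs p α β γ := by
  unfold rhs
  refine mul_nonneg (by positivity) (Finset.prod_nonneg fun j hj => ?_)
  have hp : (1:ℝ) ≤ p := by
    have := Finset.mem_range.1 hj
    exact_mod_cast (by omega : 1 ≤ p)
  have h0 : 0 ≤ ((p:ℝ) + j - 1) * γ := mul_nonneg (by linarith [Nat.cast_nonneg (α := ℝ) j]) hγ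
  have h1 := Real.Gamma_pos_of_pos (show 0 < 1 + γ + j * γ by positivity)
  have h2 := Real.Gamma_pos_of_pos (show 0 < α + j * γ by positivity)
  have h3 := Real.Gamma_pos_of_pos (show 0 < β + j * γ by positivity)
  have h4 := Real.Gamma_pos_of_pos (show 0 < 1 + γ by positivity)
  have h5 := Real.Gamma_pos_of_pos (show 0 < α + β + ((p:ℝ) + j - 1) * γ by positivity)
  positivity

theorem rhs_step (n : ℕ) {α β γ : ℝ} (hα : 0 < α) (hβ : 0 < β) (hγ : 0 < γ) :
    rhs (n+1) α β γ = Real.Gamma ((n+1) * γ) / Real.Gamma γ ^ (n+1) *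
      (Real.Gamma α * Real.Gamma β * Real.Gamma γ ^ n / Real.Gamma (α + β + n * γ)) *
      rhs n (α + γ) (β + γ) γ := by
  have hg := Real.Gamma_pos_of_pos hγ
  have hgn := Real.Gamma_pos_of_pos (show 0 < ((n:ℝ)+1) * γ by positivity)
  unfold rhs
  simp only [Finset.prod_div_distrib, Finset.prod_mul_distrib]
  rw [Finset.prod_range_succ (fun j : ℕ => Real.Gamma (1 + γ + j * γ)),
    Finset.prod_range_succ' (fun j : ℕ => Real.Gamma (α + j * γ)),
    Finset.prod_range_succ' (fun j : ℕ => Real.Gamma (β + j * γ)),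
    Finset.prod_range_succ' (fun j : ℕ => Real.Gamma (α + β + (((n+1 : ℕ):ℝ) + j - 1) * γ)),
    Finset.prod_range_succ (fun j : ℕ => Real.Gamma (1 + γ))]
  have e1 : ∀ j : ℕ, α + ((j+1 : ℕ):ℝ) * γ = α + γ + j * γ := fun j => by push_cast; ring
  have e2 : ∀ j : ℕ, β + ((j+1 : ℕ):ℝ) * γ = β + γ + j * γ := fun j => by push_cast; ring
  have e3 : ∀ j : ℕ, α + β + (((n+1 : ℕ):ℝ) + ((j+1 : ℕ):ℝ) - 1) * γ =
      α + γ + (β + γ) + ((n:ℝ) + j - 1) * γ := fun j => by push_cast; ring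
  have e4 : α + β + (((n+1 : ℕ):ℝ) + ((0 : ℕ):ℝ) - 1) * γ = α + β + n * γ := by push_cast; ring
  have e5 : Real.Gamma (1 + γ + n * γ) = (n + 1) * γ * Real.Gamma ((n+1) * γ) := by
    rw [← Real.Gamma_add_one (by positivity)]; congr 1; ring
  have e6 : Real.Gamma (1 + γ) = γ * Real.Gamma γ := by
    rw [← Real.Gamma_add_one (by positivity)]; congr 1; ring
  simp only [e1, e2, e3, e4, e5, e6, Nat.factorial_succ]
  push_cast
  simp only [zero_mul, add_zero]
  field_simp
  rw [pow_succ']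

theorem Sel_eq (n : ℕ) {γ : ℝ} (hγ : 0 < γ) : ∀ {α β : ℝ}, 0 < α → 0 < β →
    Sel n α β γ = ENNReal.ofReal (rhs n α β γ) := by
  induction n with
  | zero =>
    intro α β _ _
    have hO : O 0 = Set.univ := by
      ext t; simp [O, StrictAnti]
    simp [Sel, hO, rhs, W, V, volume_pi]
  | succ n ih =>
    intro α β hα hβ
    have h := step (n := n) hα hβ hγ
    rw [ih (by positivity) (by positivity)] at h
    have hg := Real.Gamma_pos_of_pos hγ
    have hgn := Real.Gamma_pos_of_pos (show 0 < ((n:ℝ)+1) * γ by positivity)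
    have h1 := Real.Gamma_pos_of_pos hα
    have h2 := Real.Gamma_pos_of_pos hβ
    have h3 := Real.Gamma_pos_of_pos (show 0 < α + β + n * γ by positivity)
    have hinv : ENNReal.ofReal (Real.Gamma ((n+1) * γ) / Real.Gamma γ ^ (n+1)) *
      ENNReal.ofReal (Real.Gamma γ ^ (n+1) / Real.Gamma ((n+1) * γ)) = 1 := by
      rw [← ENNReal.ofReal_mul (by positivity), ENNReal.ofReal_eq_one]
      field_simp
    rw [rhs_step n hα hβ hγ, ENNReal.ofReal_mul (by positivity), ENNReal.ofReal_mul (by positivity),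
      mul_assoc, ← h, ← mul_assoc, hinv, one_mul]

end Selb


namespace Selb
open Finset

theorem V_le_one {n : ℕ} {t : Fin n → ℝ} (ht : t ∈ O n) : V t ≤ 1 := by
  unfold V
  refine Finset.prod_le_one (fun i _ => Finset.prod_nonneg fun j _ => ?_)
    (fun i _ => Finset.prod_le_one (fun j _ => ?_) (fun j _ => ?_))
  · split_ifs <;> positivity
  · split_ifs <;> positivity
  · split_ifs
    · have h1 := ht.2 i
      have h2 := ht.2 j
      rw [abs_le]; constructor <;> linarith
    · exact le_rfl

theorem Gamma_contAt {x : ℝ} (hx : 0 < x) : ContinuousAt Real.Gamma x :=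
  (Real.differentiableAt_Gamma fun m h => by
    have : (0:ℝ) ≤ m := Nat.cast_nonneg m
    linarith).continuousAt

theorem rhs_cont (p : ℕ) {α β : ℝ} (hα : 0 < α) (hβ : 0 < β) : ContinuousAt (rhs p α β) 0 := by
  unfold rhs
  have key : ∀ c d : ℝ, 0 < c → ContinuousAt (fun γ : ℝ => Real.Gamma (c + d * γ)) 0 := by
    intro c d hc
    refine ContinuousAt.comp (g := Real.Gamma) (f := fun γ : ℝ => c + d * γ) (Gamma_contAt (by simpa using hc)) (by fun_prop)
  refine continuousAt_const.mul (tendsto_finsetProd _ fun j _ => ?_)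
  refine ContinuousAt.div ((ContinuousAt.mul ?_ (key α j hα)).mul (key β j hβ))
    (ContinuousAt.mul ?_ (key (α + β) _ (by positivity))) ?_
  · have := key 1 (1 + j) one_pos
    convert this using 3; ring
  · have := key 1 1 one_pos
    convert this using 3; ring
  · have h1 := Real.Gamma_pos_of_pos (show (0:ℝ) < 1 + 0 by norm_num)
    have h2 := Real.Gamma_pos_of_pos (show (0:ℝ) < α + β + ((p:ℝ) + j - 1) * 0 by simp; positivity)
    positivity

theorem Sel_zero (n : ℕ) {α β : ℝ} (hα : 0 < α) (hβ : 0 < β) :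
    Sel n α β 0 = ENNReal.ofReal (rhs n α β 0) := by
  set g : ℕ → ℝ := fun k => 1 / ((k:ℝ) + 1) with hg
  have hgpos : ∀ k, 0 < g k := fun k => by simp only [hg]; positivity
  have hg0 : Filter.Tendsto g Filter.atTop (nhds 0) := tendsto_one_div_add_atTop_nhds_zero_nat
  have h1 : Filter.Tendsto (fun k => Sel n α β (g k)) Filter.atTop (nhds (Sel n α β 0)) := by
    unfold Sel
    refine lintegral_tendsto_of_tendsto_of_monotone (fun k => ?_) ?_ ?_
    · have h2 := V_meas (n := n)
      have h3 := W_meas (n := n) α β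
      fun_prop
    · filter_upwards [ae_restrict_mem (O_meas n)] with t ht
      intro k l hkl
      refine ENNReal.ofReal_le_ofReal (mul_le_mul_of_nonneg_left ?_ (W_nonneg α β ht))
      refine Real.rpow_le_rpow_of_exponent_ge (V_pos ht.1.injective) (V_le_one ht) ?_
      have : g l ≤ g k := Nat.one_div_le_one_div hkl
      linarith
    · filter_upwards [ae_restrict_mem (O_meas n)] with t ht
      refine (ENNReal.continuous_ofReal.tendsto _).comp (tendsto_const_nhds.mul ?_)
      have hc : Continuous fun r : ℝ => V t ^ (2 * r) :=
        (Real.continuous_const_rpow (V_pos ht.1.injective).ne').comp (by fun_prop)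
      exact (hc.tendsto 0).comp hg0
  have h2 : Filter.Tendsto (fun k => Sel n α β (g k)) Filter.atTop (nhds (ENNReal.ofReal (rhs n α β 0))) := by
    have : (fun k => Sel n α β (g k)) = fun k => ENNReal.ofReal (rhs n α β (g k)) :=
      funext fun k => Sel_eq n (hgpos k) hα hβ
    rw [this]
    exact (ENNReal.continuous_ofReal.tendsto _).comp ((rhs_cont n hα hβ).tendsto.comp hg0)
  exact tendsto_nhds_unique h1 h2

theorem Sel_all (n : ℕ) {α β γ : ℝ} (hα : 0 < α) (hβ : 0 < β) (hγ : 0 ≤ γ) :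
    Sel n α β γ = ENNReal.ofReal (rhs n α β γ) := by
  rcases hγ.eq_or_lt with rfl | h
  · exact Sel_zero n hα hβ
  · exact Sel_eq n h hα hβ

theorem ae_ne {n : ℕ} {i j : Fin n} (hij : i ≠ j) : ∀ᵐ t : Fin n → ℝ, t i ≠ t j := by
  set s : Submodule ℝ (Fin n → ℝ) := LinearMap.ker
    ((LinearMap.proj i : (Fin n → ℝ) →ₗ[ℝ] ℝ) - LinearMap.proj j) with hs
  have hne : s ≠ ⊤ := by
    intro h
    have : (Pi.single i (1:ℝ) : Fin n → ℝ) ∈ s := by rw [h]; trivial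
    simp [hs, hij.symm] at this
  have h0 := Measure.addHaar_submodule (volume : Measure (Fin n → ℝ)) s hne
  rw [ae_iff]
  convert h0 using 2
  ext t
  simp [hs, sub_eq_zero]

theorem ae_coord {n : ℕ} (i : Fin n) (c : ℝ) : ∀ᵐ t : Fin n → ℝ, t i ≠ c := by
  rw [ae_iff]
  simpa [volume_pi] using Measure.pi_hyperplane (fun _ : Fin n => (volume : Measure ℝ)) i c

theorem closed_ae (n : ℕ) :
    ({t : Fin n → ℝ | (∀ i, 0 ≤ t i ∧ t i ≤ 1) ∧ ∀ i j : Fin n, i ≤ j → t j ≤ t i} : Set (Fin n → ℝ))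
      =ᵐ[volume] O n := by
  have h1 : ∀ᵐ t : Fin n → ℝ, ∀ i j : Fin n, i ≠ j → t i ≠ t j := by
    rw [ae_all_iff]; intro i
    rw [ae_all_iff]; intro j
    by_cases h : i = j
    · simp [h]
    · filter_upwards [ae_ne h] with t ht _ using ht
  have h2 : ∀ᵐ t : Fin n → ℝ, ∀ i, t i ≠ 0 := ae_all_iff.2 fun i => ae_coord i 0
  have h3 : ∀ᵐ t : Fin n → ℝ, ∀ i, t i ≠ 1 := ae_all_iff.2 fun i => ae_coord i 1
  filter_upwards [h1, h2, h3] with t k1 k2 k3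
  apply propext
  change ((∀ i, 0 ≤ t i ∧ t i ≤ 1) ∧ ∀ i j : Fin n, i ≤ j → t j ≤ t i) ↔
    (StrictAnti t ∧ ∀ i, 0 < t i ∧ t i < 1)
  constructor
  · rintro ⟨p1, p2⟩
    exact ⟨fun i j hij => lt_of_le_of_ne (p2 i j hij.le) (k1 j i hij.ne'), fun i =>
      ⟨lt_of_le_of_ne (p1 i).1 (k2 i).symm, lt_of_le_of_ne (p1 i).2 (k3 i)⟩⟩
  · rintro ⟨p1, p2⟩
    exact ⟨fun i => ⟨(p2 i).1.le, (p2 i).2.le⟩, fun i j hij => p1.antitone hij⟩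

theorem V_rpow {n : ℕ} {t : Fin n → ℝ} (ht : t ∈ O n) (c : ℝ) :
    ∏ j, ∏ k, (if j < k then (t j - t k) ^ c else 1) = V t ^ c := by
  unfold V
  rw [← Real.finsetProd_rpow _ _ (fun i _ => Finset.prod_nonneg fun j _ => by
    split_ifs <;> positivity)]
  refine Finset.prod_congr rfl fun i _ => ?_
  rw [← Real.finsetProd_rpow _ _ (fun j _ => by split_ifs <;> positivity)]
  refine Finset.prod_congr rfl fun j _ => ?_
  split_ifs with h
  · rw [abs_of_pos (sub_pos.2 (ht.1 h))]
  · rw [Real.one_rpow]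

end Selb

/-- **Selberg's integral formula.** For a positive integer `p` and real `α, β, γ` with
`α > 0`, `β > 0`, `γ ≥ 0`, the integral over the ordered simplex
`Δ_p = {t : 0 ≤ t_p ≤ … ≤ t_1 ≤ 1}` of
`∏_j t_j^{α-1}(1-t_j)^{β-1} ∏_{j<k} (t_j-t_k)^{2γ}` equals
`(1/p!) ∏_{j=0}^{p-1} Γ(1+γ+jγ)Γ(α+jγ)Γ(β+jγ) / (Γ(1+γ)Γ(α+β+(p+j-1)γ))`. -/
theorem selberg_integral (p : ℕ) (hp : 0 < p) (α β γ : ℝ)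
    (hα : 0 < α) (hβ : 0 < β) (hγ : 0 ≤ γ) :
    (∫ t : Fin p → ℝ in
      {t : Fin p → ℝ | (∀ i, 0 ≤ t i ∧ t i ≤ 1) ∧ ∀ i j : Fin p, i ≤ j → t j ≤ t i},
      (∏ j, (t j) ^ (α - 1) * (1 - t j) ^ (β - 1)) *
        ∏ j, ∏ k, (if j < k then (t j - t k) ^ (2 * γ) else 1))
    = (1 / (Nat.factorial p : ℝ)) * ∏ j ∈ Finset.range p,
        (Real.Gamma (1 + γ + j * γ) * Real.Gamma (α + j * γ) * Real.Gamma (β + j * γ)) /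
          (Real.Gamma (1 + γ) * Real.Gamma (α + β + ((p : ℝ) + j - 1) * γ)) := by
  rw [setIntegral_congr_set (Selb.closed_ae p)]
  have h1 : ∫ t in Selb.O p, (∏ j, (t j) ^ (α - 1) * (1 - t j) ^ (β - 1)) *
        ∏ j, ∏ k, (if j < k then (t j - t k) ^ (2 * γ) else 1) =
      ∫ t in Selb.O p, Selb.W α β t * Selb.V t ^ (2 * γ) := by
    refine setIntegral_congr_fun (Selb.O_meas p) fun t ht => ?_
    simp only [Selb.V_rpow ht, Selb.W]
  rw [h1, integral_eq_lintegral_of_nonneg_ae]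
  · change (Selb.Sel p α β γ).toReal = Selb.rhs p α β γ
    rw [Selb.Sel_all p hα hβ hγ, ENNReal.toReal_ofReal (Selb.rhs_nonneg p hα hβ hγ)]
  · filter_upwards [ae_restrict_mem (Selb.O_meas p)] with t ht
    exact mul_nonneg (Selb.W_nonneg α β ht) (Real.rpow_nonneg (Selb.V_nonneg t) _)
  · have h2 := Selb.V_meas (n := p)
    have h3 := Selb.W_meas (n := p) α β
    exact Measurable.aestronglyMeasurable (by fun_prop)
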